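/- For every N ≥ 1 and every symmetric 2-coloring φ of pairs of distinct natural numbers less than N: if P = (v_1, v_2, v_3, v_4, v_5) is a 5-element subset of {0,1,...,2^N − 1} with v_1 < ... < v_5 all five of whose 4-element subsets are edges of H, then the sequence δ_1, δ_2, δ_3, δ_4 (where δ_i = δ(v_i, v_{i+1})) is not strictly monotone, i.e., neither δ_1 < δ_2 < δ_3 < δ_4 nor δ_1 > δ_2 > δ_3 > δ_4 holds. -/

import Mathlib

/-- For distinct natural numbers `a` and `b`, `delta a b` is the largest index `i`
such that the `i`-th binary digits of `a` and `b` differ (the position of the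
highest set bit of `a XOR b`). -/
def delta (a b : ℕ) : ℕ := Nat.log 2 (a ^^^ b)

/-- The edge predicate of the 4-uniform hypergraph `H` determined by a symmetric
2-coloring `φ` of pairs: for `v₁ < v₂ < v₃ < v₄` with `δᵢ = delta vᵢ v_{i+1}`,
`(v₁,v₂,v₃,v₄)` is an edge iff one of the conditions (i), (ii), (iii) holds. -/
def IsEdge (φ : ℕ → ℕ → Bool) (v₁ v₂ v₃ v₄ : ℕ) : Prop :=
  (((delta v₁ v₂ < delta v₂ v₃ ∧ delta v₂ v₃ < delta v₃ v₄) ∨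
    (delta v₂ v₃ < delta v₁ v₂ ∧ delta v₃ v₄ < delta v₂ v₃)) ∧
    φ (delta v₁ v₂) (delta v₂ v₃) = φ (delta v₂ v₃) (delta v₃ v₄) ∧
    φ (delta v₁ v₂) (delta v₂ v₃) ≠ φ (delta v₁ v₂) (delta v₃ v₄)) ∨
  (delta v₂ v₃ < delta v₁ v₂ ∧ delta v₂ v₃ < delta v₃ v₄ ∧
    delta v₃ v₄ < delta v₁ v₂ ∧
    φ (delta v₁ v₂) (delta v₂ v₃) ≠ φ (delta v₂ v₃) (delta v₃ v₄)) ∨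
  (delta v₂ v₃ < delta v₁ v₂ ∧ delta v₂ v₃ < delta v₃ v₄ ∧
    delta v₁ v₂ < delta v₃ v₄ ∧
    φ (delta v₁ v₂) (delta v₂ v₃) = φ (delta v₁ v₂) (delta v₃ v₄) ∧
    φ (delta v₁ v₂) (delta v₃ v₄) = φ (delta v₂ v₃) (delta v₃ v₄))

/-- The highest set bit of a XOR is the larger of the two highest set bits. -/
theorem Nat.log_two_xor_of_lt {x y : ℕ} (h : Nat.log 2 x < Nat.log 2 y) :
    Nat.log 2 (x ^^^ y) = Nat.log 2 y := by
  have hy : y ≠ 0 := by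
    rintro rfl
    simp at h
  have hx : x < 2 ^ Nat.log 2 y := Nat.lt_pow_of_log_lt one_lt_two h
  have hyk : 2 ^ Nat.log 2 y ≤ y := Nat.pow_log_le_self 2 hy
  have hyk' : y < 2 ^ (Nat.log 2 y + 1) := Nat.lt_pow_succ_log_self one_lt_two y
  refine Nat.log_eq_of_pow_le_of_lt_pow ?_ (Nat.xor_lt_two_pow (hx.trans (by gcongr <;> simp)) hyk')
  by_contra! hlt
  have hlt' := Nat.xor_lt_two_pow hx hlt
  rw [Nat.xor_xor_cancel_left] at hlt'
  omega

theorem delta_eq_right_of_lt {a b c : ℕ} (h : delta a b < delta b c) :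
    delta a c = delta b c := by
  have hx : (a ^^^ b) ^^^ (b ^^^ c) = a ^^^ c := by
    rw [Nat.xor_assoc, Nat.xor_xor_cancel_left]
  have := Nat.log_two_xor_of_lt h
  rwa [hx] at this

theorem delta_comm (a b : ℕ) : delta a b = delta b a := by
  rw [delta, delta, Nat.xor_comm]

theorem delta_eq_left_of_lt {a b c : ℕ} (h : delta b c < delta a b) :
    delta a c = delta a b := by
  rw [delta_comm b c, delta_comm a b] at h
  rw [delta_comm a c, delta_comm a b, delta_eq_right_of_lt h]

theorem K5_delta_not_monotone (N : ℕ) (hN : 1 ≤ N) (φ : ℕ → ℕ → Bool)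
    (hsym : ∀ a b, φ a b = φ b a)
    (v₁ v₂ v₃ v₄ v₅ : ℕ)
    (h12 : v₁ < v₂) (h23 : v₂ < v₃) (h34 : v₃ < v₄) (h45 : v₄ < v₅)
    (hlt : v₅ < 2 ^ N)
    (e1 : IsEdge φ v₁ v₂ v₃ v₄) (e2 : IsEdge φ v₁ v₂ v₃ v₅)
    (e3 : IsEdge φ v₁ v₂ v₄ v₅) (e4 : IsEdge φ v₁ v₃ v₄ v₅)
    (e5 : IsEdge φ v₂ v₃ v₄ v₅) :
    ¬ (delta v₁ v₂ < delta v₂ v₃ ∧ delta v₂ v₃ < delta v₃ v₄ ∧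
        delta v₃ v₄ < delta v₄ v₅) ∧
    ¬ (delta v₂ v₃ < delta v₁ v₂ ∧ delta v₃ v₄ < delta v₂ v₃ ∧
        delta v₄ v₅ < delta v₃ v₄) := by
  constructor
  · rintro ⟨h₁, h₂, h₃⟩
    have h24 := delta_eq_right_of_lt h₂
    have h13 := delta_eq_right_of_lt h₁
    simp only [IsEdge, h24, h13] at e1 e3 e4
    grind
  · rintro ⟨h₁, h₂, h₃⟩
    have h13 := delta_eq_left_of_lt h₁
    simp only [IsEdge, h13] at e1 e4 e5
    grind
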